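/- Let σ > 0, let w : ℝ² → ℝ be L-Lipschitz with |w(p)| ≤ B for all p (Euclidean norm on ℝ²), and fix q ∈ ℝ². Then the persistence surface evaluation map (ℝ²)^p → ℝ, D = (p_1, …, p_p) ↦ ρ_D(q) = Σ_{i=1}^p w(p_i) · exp(−‖q − p_i‖²/(2σ²)), is Lipschitz with constant p · (L + B e^{−1/2}/σ) with respect to the metric d(D, D') = max_{1 ≤ i ≤ p} ‖p_i − p_i'‖. -/

import Mathlib

/-- The persistence surface of a diagram `D = (p_1, …, p_p) ∈ (ℝ²)^p` with weight
function `w` and bandwidth `σ`, evaluated at `q ∈ ℝ²`: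
`ρ_D(q) = Σ_{i=1}^p w(p_i) · exp(−‖q − p_i‖²/(2σ²))` (Euclidean norm on `ℝ²`). -/
noncomputable def persistenceSurface {p : ℕ} (w : EuclideanSpace ℝ (Fin 2) → ℝ)
    (σ : ℝ) (D : Fin p → EuclideanSpace ℝ (Fin 2)) (q : EuclideanSpace ℝ (Fin 2)) : ℝ :=
  ∑ i, w (D i) * Real.exp (-‖q - D i‖ ^ 2 / (2 * σ ^ 2))

/-- The derivative of the Gaussian `t ↦ exp(−t²/(2σ²))` is bounded by `e^{−1/2}/σ`. -/
lemma abs_gaussian_deriv_le {σ : ℝ} (hσ : 0 < σ) (t : ℝ) :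
    |Real.exp (-t ^ 2 / (2 * σ ^ 2)) * (-t / σ ^ 2)| ≤ Real.exp (-(1 / 2)) / σ := by
  set u := |t| / σ with hu
  have hexp : -t ^ 2 / (2 * σ ^ 2) = -(u ^ 2 / 2) := by
    rw [hu, div_pow, sq_abs]
    field_simp
  have hle : u ≤ Real.exp ((u ^ 2 - 1) / 2) := by
    nlinarith [Real.add_one_le_exp ((u ^ 2 - 1) / 2), sq_nonneg (u - 1)]
  have hsplit : Real.exp (-(u ^ 2 / 2)) * Real.exp ((u ^ 2 - 1) / 2) = Real.exp (-(1 / 2)) := by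
    rw [← Real.exp_add]
    congr 1
    ring
  have hmul : |-t / σ ^ 2| = u / σ := by
    rw [hu, abs_div, abs_neg, abs_of_pos (pow_pos hσ 2)]
    field_simp
  rw [abs_mul, Real.abs_exp, hexp, hmul, ← mul_div_assoc, ← hsplit]
  gcongr

lemma abs_gaussian_sub_le {σ : ℝ} (hσ : 0 < σ) (s t : ℝ) :
    |Real.exp (-s ^ 2 / (2 * σ ^ 2)) - Real.exp (-t ^ 2 / (2 * σ ^ 2))| ≤
      Real.exp (-(1 / 2)) / σ * |s - t| := by
  have hderiv : ∀ x ∈ (Set.univ : Set ℝ),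
      HasDerivWithinAt (fun x : ℝ ↦ Real.exp (-x ^ 2 / (2 * σ ^ 2)))
        (Real.exp (-x ^ 2 / (2 * σ ^ 2)) * (-x / σ ^ 2)) Set.univ x := by
    intro x _
    have h := (((hasDerivAt_pow 2 x).neg).div_const (2 * σ ^ 2)).exp
    refine (h.congr_deriv ?_).hasDerivWithinAt
    simp only [Pi.neg_apply]
    field_simp
    norm_num [mul_comm]
  exact convex_univ.norm_image_sub_le_of_norm_hasDerivWithin_le hderiv
    (fun x _ ↦ abs_gaussian_deriv_le hσ x) (Set.mem_univ t) (Set.mem_univ s)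

/-- A bounded Lipschitz weight times a Gaussian bump centred at `q` is Lipschitz. -/
lemma abs_weighted_gaussian_sub_le {E : Type*} [SeminormedAddCommGroup E] {σ L B : ℝ}
    (hσ : 0 < σ) {w : E → ℝ} (hw : ∀ a b, |w a - w b| ≤ L * ‖a - b‖) (hB : ∀ a, |w a| ≤ B)
    (q a b : E) :
    |w a * Real.exp (-‖q - a‖ ^ 2 / (2 * σ ^ 2)) - w b * Real.exp (-‖q - b‖ ^ 2 / (2 * σ ^ 2))| ≤
      (L + B * Real.exp (-(1 / 2)) / σ) * ‖a - b‖ := by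
  set g : E → ℝ := fun x ↦ Real.exp (-‖q - x‖ ^ 2 / (2 * σ ^ 2)) with hg
  have hg_le : |g a| ≤ 1 := by
    rw [hg, Real.abs_exp, Real.exp_le_one_iff]
    exact div_nonpos_of_nonpos_of_nonneg (neg_nonpos.2 (sq_nonneg _)) (by positivity)
  have hnorm : |‖q - a‖ - ‖q - b‖| ≤ ‖a - b‖ := by
    have h := abs_norm_sub_norm_le (q - a) (q - b)
    rwa [sub_sub_sub_cancel_left, norm_sub_rev b a] at h
  have hg_sub : |g a - g b| ≤ Real.exp (-(1 / 2)) / σ * ‖a - b‖ :=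
    (abs_gaussian_sub_le hσ _ _).trans (by gcongr)
  calc |w a * g a - w b * g b| = |(w a - w b) * g a + w b * (g a - g b)| := by ring_nf
    _ ≤ |w a - w b| * |g a| + |w b| * |g a - g b| := by
      rw [← abs_mul, ← abs_mul]
      exact abs_add_le _ _
    _ ≤ L * ‖a - b‖ * 1 + B * (Real.exp (-(1 / 2)) / σ * ‖a - b‖) := by
      refine add_le_add (mul_le_mul (hw a b) hg_le (abs_nonneg _) ((abs_nonneg _).trans (hw a b)))
        (mul_le_mul (hB b) hg_sub (abs_nonneg _) ((abs_nonneg _).trans (hB b)))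
    _ = (L + B * Real.exp (-(1 / 2)) / σ) * ‖a - b‖ := by ring

/-- If `w : ℝ² → ℝ` is `L`-Lipschitz and bounded by `B`, then for each fixed `q ∈ ℝ²`
the persistence surface evaluation `D ↦ ρ_D(q)` is Lipschitz with constant
`p · (L + B e^{−1/2}/σ)` with respect to the metric
`d(D, D') = max_{1 ≤ i ≤ p} ‖p_i − p_i'‖` (the `dist` of the sup metric on
`Fin p → ℝ²`). -/
theorem persistenceSurface_lipschitz {p : ℕ} (σ L B : ℝ) (hσ : 0 < σ)
    (w : EuclideanSpace ℝ (Fin 2) → ℝ)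
    (hw : ∀ a b : EuclideanSpace ℝ (Fin 2), |w a - w b| ≤ L * ‖a - b‖)
    (hB : ∀ a : EuclideanSpace ℝ (Fin 2), |w a| ≤ B)
    (q : EuclideanSpace ℝ (Fin 2)) (D D' : Fin p → EuclideanSpace ℝ (Fin 2)) :
    |persistenceSurface w σ D q - persistenceSurface w σ D' q| ≤
      p * (L + B * Real.exp (-(1 / 2)) / σ) * dist D D' := by
  have hB0 : 0 ≤ B := (abs_nonneg _).trans (hB 0)
  have hL0 : 0 ≤ L := by
    obtain ⟨v, hv⟩ := exists_ne (0 : EuclideanSpace ℝ (Fin 2))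
    refine nonneg_of_mul_nonneg_left ((abs_nonneg _).trans (hw v 0)) ?_
    rw [sub_zero]
    exact norm_pos_iff.2 hv
  unfold persistenceSurface
  rw [← Finset.sum_sub_distrib]
  calc _ ≤ ∑ i, |w (D i) * Real.exp (-‖q - D i‖ ^ 2 / (2 * σ ^ 2)) -
          w (D' i) * Real.exp (-‖q - D' i‖ ^ 2 / (2 * σ ^ 2))| := Finset.abs_sum_le_sum_abs _ _
    _ ≤ ∑ _i : Fin p, (L + B * Real.exp (-(1 / 2)) / σ) * dist D D' := by
      refine Finset.sum_le_sum fun i _ ↦ (abs_weighted_gaussian_sub_le hσ hw hB q _ _).trans ?_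
      rw [← dist_eq_norm]
      gcongr
      exact dist_le_pi_dist D D' i
    _ = p * (L + B * Real.exp (-(1 / 2)) / σ) * dist D D' := by
      simp [mul_assoc]
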